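/- Let X be an irreducible normal variety of dimension n, G ⊆ Aut(X) a connected subgroup, and f₁,…,f_n ∈ O(X) such that each zero set Z_i = V(f_i) is an irreducible G-invariant hypersurface and ⋂_i Z_i contains an isolated point. Then the product character χ = (χ₁,…,χ_n) : G → (ℂ*)^n, where χ_i is the character of the semi-invariant f_i, is a group homomorphism with finite kernel. -/

import Mathlib

open AlgebraicGeometry CategoryTheory Limits

/-- Evaluation of an algebraic family `F : A × X ⟶ X` of endomorphisms of `X`,
parametrized by a variety `A`, at a ℂ-point `a` of `A`. -/
noncomputable def famEval {X A : Scheme} (f : X ⟶ Spec (CommRingCat.of ℂ))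
    (fA : A ⟶ Spec (CommRingCat.of ℂ)) (F : pullback fA f ⟶ X)
    (a : Spec (CommRingCat.of ℂ) ⟶ A) (ha : a ≫ fA = 𝟙 _) : X ⟶ X :=
  pullback.lift (f ≫ a) (𝟙 X)
    (by rw [Category.assoc, ha, Category.comp_id, Category.id_comp]) ≫ F

/-- A subgroup `G ⊆ Aut(X)` is connected if every `g ∈ G` lies, together with the
identity, in the image of an algebraic family of automorphisms parametrized by an
irreducible variety, all of whose members belong to `G`. -/
def IsConnSubgroup {X : Scheme} (f : X ⟶ Spec (CommRingCat.of ℂ))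
    (G : Subgroup (Aut (CategoryTheory.Over.mk f))) : Prop :=
  ∀ g ∈ G, ∃ (A : Scheme) (fA : A ⟶ Spec (CommRingCat.of ℂ))
      (_ : IrreducibleSpace A) (F : pullback fA f ⟶ X),
    (∀ (a : Spec (CommRingCat.of ℂ) ⟶ A) (ha : a ≫ fA = 𝟙 _),
      ∃ φ ∈ G, famEval f fA F a ha = (φ : Aut (Over.mk f)).hom.left) ∧
    (∃ a ha, famEval f fA F a ha = g.hom.left) ∧
    (∃ a ha, famEval f fA F a ha = 𝟙 X)

/-- The constant functions: `ℂ → Γ(X, ⊤)`. -/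
noncomputable def cConst {X : Scheme} (f : X ⟶ Spec (CommRingCat.of ℂ)) :
    CommRingCat.of ℂ ⟶ Γ(X, ⊤) :=
  (Scheme.ΓSpecIso (CommRingCat.of ℂ)).inv ≫ f.appTop

/-- Evaluation of global functions on `A` at a ℂ-point `a` of `A`. -/
noncomputable def cEval {A : Scheme} (a : Spec (CommRingCat.of ℂ) ⟶ A) :
    Γ(A, ⊤) ⟶ CommRingCat.of ℂ :=
  a.appTop ≫ (Scheme.ΓSpecIso (CommRingCat.of ℂ)).hom

/-- If a domain `A` of finite type over `R` is algebraic over `R`, then there are only finitely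
many `R`-algebra homomorphisms from `A` to a domain containing `R`. -/
theorem Algebra.IsAlgebraic.finite_algHom (R A L : Type*) [CommRing R] [CommRing A] [CommRing L]
    [IsDomain L] [Algebra R A] [Algebra R L] [FaithfulSMul R L]
    [Algebra.FiniteType R A] [Algebra.IsAlgebraic R A] : Finite (A →ₐ[R] L) := by
  have : IsDomain R := (FaithfulSMul.algebraMap_injective R L).isDomain
  have : Module.IsTorsionFree R L := inferInstance
  obtain ⟨s, hs⟩ := Algebra.FiniteType.out (R := R) (A := A)
  choose p hp hroot using fun x : A ↦ Algebra.IsAlgebraic.isAlgebraic (R := R) x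
  have key (φ : A →ₐ[R] L) (x : s) : φ x ∈ (p x).rootSet L := by
    rw [Polynomial.mem_rootSet]
    exact ⟨hp x, by rw [Polynomial.aeval_algHom_apply, hroot, map_zero]⟩
  have (x : s) : Finite ((p x).rootSet L) := (Polynomial.rootSet_finite _ _).to_subtype
  refine Finite.of_injective
    (fun (φ : A →ₐ[R] L) (x : s) ↦ (⟨φ x, key φ x⟩ : (p x).rootSet L)) fun φ ψ h ↦ ?_
  refine AlgHom.ext_of_adjoin_eq_top hs fun x hx ↦ ?_
  exact congrArg Subtype.val (congrFun h ⟨x, hx⟩)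

/-- By Zariski's main theorem, a domain that is of finite type over `R` and quasi-finite at one
prime is algebraic over `R`. -/
theorem Algebra.QuasiFiniteAt.isAlgebraic {R A : Type*} [CommRing R] [CommRing A] [IsDomain A]
    [Algebra R A] [FaithfulSMul R A] [Algebra.FiniteType R A] (p : Ideal A) [p.IsPrime]
    [Algebra.QuasiFiniteAt R p] : Algebra.IsAlgebraic R A := by
  have : IsDomain R := (FaithfulSMul.algebraMap_injective R A).isDomain
  obtain ⟨r, hrp, hr, hint⟩ := Algebra.zariskisMainProperty_iff.mp
    (Algebra.ZariskisMainProperty.of_finiteType (R := R) p)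
  have hr0 : r ≠ 0 := fun h ↦ hrp (h ▸ p.zero_mem)
  refine ⟨fun x ↦ ?_⟩
  obtain ⟨m, hm⟩ := hint x
  exact .of_mul (mem_nonZeroDivisors_of_ne_zero (pow_ne_zero m hr0))
    (hr.isAlgebraic.pow m) hm.isAlgebraic

/-- If the common vanishing locus of elements `a i` of a domain `A` of finite type
over `k` is a single point, then a homomorphism from `A` to a domain is determined up to finitely
many choices by its values on `k` and on the `a i`. -/
theorem finite_algHom_of_zeroLocus_eq_singleton {k A L ι : Type*} [CommRing k] [CommRing A]
    [IsDomain A] [CommRing L] [IsDomain L] [Algebra k A] [Algebra k L] [Algebra.FiniteType k A]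
    (a : ι → A) (m : PrimeSpectrum A) (h : PrimeSpectrum.zeroLocus (Set.range a) = {m})
    (j : A →ₐ[k] L) (hj : Function.Injective j) :
    {φ : A →ₐ[k] L | ∀ i, φ (a i) = j (a i)}.Finite := by
  let R := Algebra.adjoin k (Set.range a)
  have : Algebra.FiniteType R A := .of_restrictScalars_finiteType k R A
  let : Algebra R L := (j.comp R.val).toRingHom.toAlgebra
  have : FaithfulSMul R L :=
    (faithfulSMul_iff_algebraMap_injective R L).mpr (hj.comp Subtype.val_injective)
  have : Algebra.QuasiFiniteAt R m.asIdeal := by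
    refine .of_isOpen_singleton_fiber m ?_
    convert! isOpen_univ
    refine Set.eq_univ_of_forall fun ⟨q, hq⟩ ↦ Subtype.ext ?_
    rw [← Set.mem_singleton_iff, ← h]
    rintro _ ⟨i, rfl⟩
    have hm : a i ∈ m.asIdeal := h.ge (Set.mem_singleton m) ⟨i, rfl⟩
    exact (congrArg PrimeSpectrum.asIdeal hq).ge
      (show (⟨a i, Algebra.subset_adjoin ⟨i, rfl⟩⟩ : R) ∈ _ from hm)
  have : Algebra.IsAlgebraic R A := Algebra.QuasiFiniteAt.isAlgebraic m.asIdeal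
  have := Algebra.IsAlgebraic.finite_algHom R A L
  have agree (φ : {φ : A →ₐ[k] L | ∀ i, φ (a i) = j (a i)}) : R ≤ AlgHom.equalizer φ.1 j :=
    Algebra.adjoin_le (by rintro _ ⟨i, rfl⟩; exact φ.2 i)
  refine Set.finite_coe_iff.mp ?_
  refine Finite.of_injective (β := A →ₐ[R] L)
    (fun φ ↦ { toRingHom := φ.1.toRingHom, commutes' := fun r ↦ agree φ r.2 }) fun φ ψ h ↦ ?_
  exact Subtype.ext (AlgHom.ext fun x ↦ DFunLike.congr_fun h x)

namespace AlgebraicGeometry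

/-- If the common zero locus of the global functions `a i` meets an affine open `V` in one point, then
the zero locus of their restrictions in the spectrum of the sections over `V` is one point. -/
theorem IsAffineOpen.zeroLocus_range_res_eq_singleton {X : Scheme} {V : X.Opens}
    (hV : IsAffineOpen V) {ι : Type*} (a : ι → Γ(X, ⊤)) {z : X}
    (h : (V : Set X) ∩ {x | ∀ i, x ∉ X.basicOpen (a i)} = {z}) :
    ∃ m, PrimeSpectrum.zeroLocus
      (Set.range fun i ↦ X.presheaf.map (homOfLE le_top : V ⟶ ⊤).op (a i)) = {m} := by
  have hmem (p : Spec Γ(X, V)) :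
      p ∈ PrimeSpectrum.zeroLocus
        (Set.range fun i ↦ X.presheaf.map (homOfLE le_top : V ⟶ ⊤).op (a i)) ↔
        hV.fromSpec p = z := by
    have hpV : hV.fromSpec p ∈ V := hV.range_fromSpec.le ⟨p, rfl⟩
    rw [← Set.mem_singleton_iff (b := z), ← h]
    refine (Set.range_subset_iff.trans (forall_congr' fun i ↦ ?_)).trans (and_iff_right hpV).symm
    have : hV.fromSpec p ∈ X.basicOpen (X.presheaf.map (homOfLE le_top : V ⟶ ⊤).op (a i)) ↔
        X.presheaf.map (homOfLE le_top : V ⟶ ⊤).op (a i) ∉ p.asIdeal :=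
      SetLike.ext_iff.mp (hV.fromSpec_preimage_basicOpen _) p
    rw [SetLike.mem_coe, ← not_iff_not, ← this, Scheme.basicOpen_res]
    simp [hpV]
  obtain ⟨m, hm⟩ := hV.range_fromSpec.ge (h.ge rfl).1
  refine ⟨m, Set.ext fun p ↦ (hmem p).trans ?_⟩
  exact hm ▸ hV.fromSpec.isOpenEmbedding.injective.eq_iff

/-- Two morphisms from an integral scheme to a separated scheme agree if they map the generic point
into a common affine open `V` and induce the same map from the sections over `V` to the function
field. -/
theorem ext_of_app_germ_genericPoint {X Y S : Scheme} [IsIntegral X] (s : Y ⟶ S) [IsSeparated s]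
    {g g' : X ⟶ Y} (hs : g ≫ s = g' ≫ s) {V : Y.Opens} (hV : IsAffineOpen V)
    (hg : genericPoint X ∈ g ⁻¹ᵁ V) (hg' : genericPoint X ∈ g' ⁻¹ᵁ V)
    (h : g.app V ≫ X.presheaf.germ _ _ hg = g'.app V ≫ X.presheaf.germ _ _ hg') : g = g' := by
  let W := g ⁻¹ᵁ V ⊓ g' ⁻¹ᵁ V
  have hW : genericPoint X ∈ W := ⟨hg, hg'⟩
  have : IsAffine V := hV
  have : Mono (X.presheaf.germ W _ hW) :=
    ConcreteCategory.mono_of_injective _ (germ_injective_of_isIntegral _ _ hW)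
  have happ : g.appLE V W inf_le_left = g'.appLE V W inf_le_right := by
    rw [← cancel_mono (X.presheaf.germ W _ hW)]
    simpa [Scheme.Hom.appLE] using h
  have hres : g.resLE V W inf_le_left = g'.resLE V W inf_le_right := by
    refine ext_of_isAffine ?_
    simp [Scheme.Hom.appTop, happ]
  have : IsDominant W.ι := by
    constructor
    rw [DenseRange, Scheme.Opens.range_ι]
    exact W.isOpen.dense ⟨_, hW⟩
  refine ext_of_isDominant_of_isSeparated s hs W.ι ?_
  rw [← Scheme.Hom.resLE_comp_ι g inf_le_left, hres, Scheme.Hom.resLE_comp_ι]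

/-- If the common zero locus of the global functions `a i` on an integral scheme `X`, separated and
locally of finite type over an affine base, has an isolated point, then only finitely many
dominant endomorphisms of `X` fix all the `a i`. -/
theorem finite_isDominant_fixing {X S : Scheme} [IsAffine S] (f : X ⟶ S) [IsIntegral X]
    [IsSeparated f] [LocallyOfFiniteType f] {ι : Type*} (a : ι → Γ(X, ⊤)) {z : X} {U : Set X}
    (hU : IsOpen U) (h : U ∩ {x | ∀ i, x ∉ X.basicOpen (a i)} = {z}) :
    {g : X ⟶ X | g ≫ f = f ∧ IsDominant g ∧ ∀ i, g.appTop (a i) = a i}.Finite := by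
  have hzU : z ∈ U := (h.ge rfl).1
  obtain ⟨_, ⟨V, hV, rfl⟩, hzV, hVU⟩ :=
    X.isBasis_affineOpens.exists_subset_of_mem_open hzU hU
  have hz : (V : Set X) ∩ {x | ∀ i, x ∉ X.basicOpen (a i)} = {z} :=
    Set.Subset.antisymm ((Set.inter_subset_inter_left _ hVU).trans h.le)
      (Set.singleton_subset_iff.mpr ⟨hzV, (h.ge rfl).2⟩)
  obtain ⟨m, hm⟩ := IsAffineOpen.zeroLocus_range_res_eq_singleton hV a hz
  have : Nonempty V := ⟨⟨z, hzV⟩⟩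
  have e : V ≤ f ⁻¹ᵁ ⊤ := le_top
  let : Algebra Γ(S, ⊤) Γ(X, V) := (f.appLE ⊤ V e).hom.toAlgebra
  have : Algebra.FiniteType Γ(S, ⊤) Γ(X, V) :=
    f.finiteType_appLE (isAffineOpen_top S) hV e
  let : Algebra Γ(S, ⊤) X.functionField :=
    (f.appLE ⊤ V e ≫ X.germToFunctionField V).hom.toAlgebra
  let j : Γ(X, V) →ₐ[Γ(S, ⊤)] X.functionField :=
    { toRingHom := (X.germToFunctionField V).hom, commutes' := fun _ ↦ rfl }
  have hfin := finite_algHom_of_zeroLocus_eq_singleton _ m hm j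
    (X.germToFunctionField_injective V)
  have hη (g : {g : X ⟶ X | g ≫ f = f ∧ IsDominant g ∧ ∀ i, g.appTop (a i) = a i}) :
      genericPoint X ∈ g.1 ⁻¹ᵁ V := by
    have := g.2.2.1
    obtain ⟨x, hx⟩ := g.1.denseRange.exists_mem_open V.isOpen ⟨z, hzV⟩
    exact ((genericPoint_spec X).mem_open_set_iff (g.1 ⁻¹ᵁ V).isOpen).mpr ⟨x, trivial, hx⟩
  have hgerm (g) : X.presheaf.map (homOfLE le_top : V ⟶ ⊤).op ≫ g.1.app V ≫
      X.presheaf.germ _ _ (hη g) = g.1.appTop ≫ X.presheaf.germ ⊤ (genericPoint X) trivial := by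
    rw [g.1.naturality_assoc]
    simp
  have hres : X.presheaf.map (homOfLE le_top : V ⟶ ⊤).op ≫ X.germToFunctionField V =
      X.presheaf.germ ⊤ (genericPoint X) trivial := by simp
  let Φ (g : {g : X ⟶ X | g ≫ f = f ∧ IsDominant g ∧ ∀ i, g.appTop (a i) = a i}) :
      Γ(X, V) →ₐ[Γ(S, ⊤)] X.functionField :=
    { toRingHom := (g.1.app V ≫ X.presheaf.germ _ _ (hη g)).hom
      commutes' := fun r ↦ by
        have hf : f.appTop ≫ g.1.appTop = f.appTop := by
          rw [← Scheme.Hom.comp_appTop, g.2.1]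
        have : f.appLE ⊤ V e ≫ g.1.app V ≫ X.presheaf.germ _ _ (hη g) =
            f.appLE ⊤ V e ≫ X.germToFunctionField V := by
          rw [Scheme.Hom.appLE, Category.assoc, Category.assoc]
          exact (congrArg (f.appTop ≫ ·) (hgerm g)).trans
            (((reassoc_of% hf) _).trans (congrArg (f.appTop ≫ ·) hres.symm))
        exact ConcreteCategory.congr_hom this r }
  have hΦ (g) : Φ g ∈ {φ : Γ(X, V) →ₐ[Γ(S, ⊤)] X.functionField |
      ∀ i, φ (X.presheaf.map (homOfLE le_top : V ⟶ ⊤).op (a i)) =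
        j (X.presheaf.map (homOfLE le_top : V ⟶ ⊤).op (a i))} := fun i ↦ by
    refine (ConcreteCategory.congr_hom (hgerm g) (a i)).trans ?_
    refine Eq.trans ?_ (ConcreteCategory.congr_hom hres (a i)).symm
    rw [ConcreteCategory.comp_apply, g.2.2.2 i]
  have := hfin.to_subtype
  refine Set.finite_coe_iff.mp (Finite.of_injective (Set.codRestrict Φ _ hΦ) fun g g' hgg' ↦ Subtype.ext ?_)
  refine ext_of_app_germ_genericPoint f (g.2.1.trans g'.2.1.symm) hV (hη g) (hη g') ?_
  ext x
  exact DFunLike.congr_fun (congrArg Subtype.val hgg') x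

end AlgebraicGeometry

/-- Let `X` be an irreducible normal complex variety of dimension `n`,
`G ⊆ Aut(X)` a connected subgroup, and `f 1, …, f n ∈ O(X)` semi-invariants with
characters `χ 1, …, χ n` whose zero sets `Z i` are irreducible `G`-invariant
hypersurfaces such that `⋂ᵢ Z i` contains an isolated point. Then the product character
`(χ 1, …, χ n) : G → (ℂ*)ⁿ` (a group homomorphism) has finite kernel. -/
theorem stmt_14 (X : Scheme) (f : X ⟶ Spec (CommRingCat.of ℂ))
    [IsIntegral X] [IsSeparated f] [LocallyOfFiniteType f] [QuasiCompact f]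
    (hnormal : ∀ x : X, IsIntegrallyClosed (X.presheaf.stalk x))
    (n : ℕ) (hdim : topologicalKrullDim X = n)
    (G : Subgroup (Aut (Over.mk f))) (hconn : IsConnSubgroup f G)
    (fel : Fin n → Γ(X, ⊤)) (Z : Fin n → Set X)
    (hZ : ∀ i, Z i = ((X.basicOpen (fel i) : X.Opens) : Set X)ᶜ)
    (hirr : ∀ i, IsIrreducible (Z i))
    (hcodim : ∀ i, ∃ z : X, closure {z} = Z i ∧ ringKrullDim (X.presheaf.stalk z) = 1)
    (hstab : ∀ i, ∀ g ∈ G, (g : Aut (Over.mk f)).hom.left.base '' Z i = Z i)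
    (χ : Fin n → (G →* ℂˣ))
    (hsemi : ∀ i, ∀ g : G, (g : Aut (Over.mk f)).hom.left.appTop (fel i) =
      cConst f (((χ i g)⁻¹ : ℂˣ) : ℂ) * fel i)
    (hisol : ∃ z : X, (∀ i, z ∈ Z i) ∧
      ∃ U : Set X, IsOpen U ∧ U ∩ (⋂ i, Z i) = {z}) :
    Set.Finite {g : G | ∀ i, χ i g = 1} := by
  obtain ⟨z, -, U, hU, hUz⟩ := hisol
  have hfin := finite_isDominant_fixing f fel (z := z) hU (by
    rw [← hUz]; congr 1; ext x; simp [hZ])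
  refine Set.Finite.of_finite_image (f := fun g : G ↦ (g : Aut (Over.mk f)).hom.left)
    (hfin.subset ?_) fun g _ g' _ h ↦ Subtype.ext (Iso.ext (Over.OverMorphism.ext h))
  rintro _ ⟨g, hg, rfl⟩
  have : IsIso (g : Aut (Over.mk f)).hom := Iso.isIso_hom (X := Over.mk f) (Y := Over.mk f) g.1
  have : IsIso (g : Aut (Over.mk f)).hom.left := inferInstanceAs (IsIso ((Over.forget _).map _))
  refine ⟨Over.w (g : Aut (Over.mk f)).hom, inferInstanceAs (IsDominant g.1.hom.left), fun i ↦ ?_⟩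
  rw [hsemi i g, hg i]
  simp
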